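/- Let N ≥ 2 and let S_1,…,S_N be nonnegative integers with T = Σ_i S_i. If max_i S_i < ⌈T/2⌉, then there exists a vector x ∈ ℤ_{≥0}^ℱ satisfying Σ_{j<i} x_{ji} + Σ_{j>i} x_{ij} ≤ S_i for every node i and Σ_{i<j} x_{ij} = ⌊T/2⌋. -/

import Mathlib

open Finset

/-- Total number of units allocated over unordered pairs `i < j`. -/
def pairTotal (N : ℕ) (x : Fin N → Fin N → ℕ) : ℕ :=
  ∑ i : Fin N, ∑ j : Fin N, if i < j then x i j else 0

/-- Degree of the allocation at node `i`: `∑_{j<i} x_{ji} + ∑_{j>i} x_{ij}`. -/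
def nodeDeg (N : ℕ) (x : Fin N → Fin N → ℕ) (i : Fin N) : ℕ :=
  (∑ j : Fin N, if j < i then x j i else 0) + (∑ j : Fin N, if i < j then x i j else 0)

lemma pairTotal_add (N : ℕ) (x y : Fin N → Fin N → ℕ) :
    pairTotal N (fun i j => x i j + y i j) = pairTotal N x + pairTotal N y := by
  unfold pairTotal
  rw [← Finset.sum_add_distrib]
  refine Finset.sum_congr rfl fun i _ => ?_
  rw [← Finset.sum_add_distrib]
  refine Finset.sum_congr rfl fun j _ => ?_
  split_ifs <;> rfl

lemma nodeDeg_add (N : ℕ) (x y : Fin N → Fin N → ℕ) (i : Fin N) :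
    nodeDeg N (fun i j => x i j + y i j) i = nodeDeg N x i + nodeDeg N y i := by
  unfold nodeDeg
  have key : ∀ (p : Prop) [Decidable p] (m n : ℕ),
      (if p then m + n else 0) = (if p then m else 0) + (if p then n else 0) := by
    intro p _ m n
    split_ifs <;> rfl
  simp only [key, Finset.sum_add_distrib]
  ring

lemma pairTotal_unit (N : ℕ) (a b : Fin N) (hab : a < b) :
    pairTotal N (fun i j => if i = a then if j = b then 1 else 0 else 0) = 1 := by
  unfold pairTotal
  rw [Finset.sum_eq_single a, Finset.sum_eq_single b] <;> simp_all

lemma nodeDeg_unit (N : ℕ) (a b : Fin N) (hab : a < b) (i : Fin N) :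
    nodeDeg N (fun i j => if i = a then if j = b then 1 else 0 else 0) i
      = (if i = a then 1 else 0) + (if i = b then 1 else 0) := by
  unfold nodeDeg
  rw [add_comm]
  congr 1
  · rw [Finset.sum_eq_single b]
    · by_cases h : i = a <;> simp_all
    · intro j _ hj; simp [hj]
    · simp
  · rw [Finset.sum_eq_single a]
    · by_cases h : i = b <;> simp_all
    · intro j _ hj; simp [hj]
    · simp

lemma exists_pair (N : ℕ) (S : Fin N → ℕ) (hT : 2 ≤ ∑ i, S i)
    (h : ∀ i, 2 * S i ≤ (∑ i, S i) + 1) :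
    ∃ a b : Fin N, a < b ∧ 1 ≤ S a ∧ 1 ≤ S b ∧
      ∀ c, c ≠ a → c ≠ b → 2 * S c + 1 ≤ ∑ i, S i := by
  have hne : (univ : Finset (Fin N)).Nonempty := by
    by_contra hn
    rw [Finset.not_nonempty_iff_eq_empty] at hn
    simp [hn] at hT
  obtain ⟨a, _, ha⟩ := Finset.exists_max_image univ S hne
  have h1 : S a + ∑ i ∈ univ.erase a, S i = ∑ i, S i := Finset.add_sum_erase _ _ (mem_univ a)
  have hne2 : (univ.erase a).Nonempty := by
    by_contra hn
    rw [Finset.not_nonempty_iff_eq_empty] at hn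
    rw [hn, Finset.sum_empty] at h1
    have := h a
    omega
  obtain ⟨b, hb, hb'⟩ := Finset.exists_max_image (univ.erase a) S hne2
  have h2 : S b + ∑ i ∈ (univ.erase a).erase b, S i = ∑ i ∈ univ.erase a, S i :=
    Finset.add_sum_erase _ _ hb
  have hba : b ≠ a := (Finset.mem_erase.1 hb).1
  have hSb : 1 ≤ S b := by
    by_contra hn
    have : ∑ i ∈ univ.erase a, S i = 0 := Finset.sum_eq_zero fun i hi => by
      have := hb' i hi
      omega
    have := h a
    omega
  have hSa : S b ≤ S a := ha b (mem_univ b)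
  have hc : ∀ c, c ≠ a → c ≠ b → 2 * S c + 1 ≤ ∑ i, S i := by
    intro c hca hcb
    have hc1 : c ∈ univ.erase a := by simp [hca]
    have h3 : S c ≤ ∑ i ∈ (univ.erase a).erase b, S i :=
      Finset.single_le_sum (f := S) (fun _ _ => Nat.zero_le _) (Finset.mem_erase.2 ⟨hcb, hc1⟩)
    have := hb' c hc1
    omega
  rcases lt_or_gt_of_ne hba with hlt | hlt
  · exact ⟨b, a, hlt, hSb, by omega, fun c h1 h2 => hc c h2 h1⟩
  · exact ⟨a, b, hlt, by omega, hSb, hc⟩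

lemma pairing_aux (N k : ℕ) : ∀ S : Fin N → ℕ, (∑ i, S i) / 2 = k →
    (∀ i, 2 * S i ≤ (∑ i, S i) + 1) →
    ∃ x : Fin N → Fin N → ℕ, (∀ i, nodeDeg N x i ≤ S i) ∧ pairTotal N x = k := by
  induction k with
  | zero =>
    intro S _ _
    exact ⟨fun _ _ => 0, by simp [nodeDeg], by simp [pairTotal]⟩
  | succ k ih =>
    intro S hk h
    obtain ⟨a, b, hab, hSa, hSb, hc⟩ := exists_pair N S (by omega) h
    let e : Fin N → ℕ := fun i => (if i = a then 1 else 0) + (if i = b then 1 else 0)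
    have he : ∀ i, e i ≤ S i := by
      intro i
      by_cases h1 : i = a
      · subst h1; simpa [e, hab.ne] using hSa
      · by_cases h2 : i = b
        · subst h2; simpa [e, hab.ne'] using hSb
        · simp [e, h1, h2]
    have hes : ∑ i, e i = 2 := by simp [e, Finset.sum_add_distrib]
    have hs : ∑ i, (S i - e i) + 2 = ∑ i, S i := by
      rw [← hes, ← Finset.sum_add_distrib]
      exact Finset.sum_congr rfl fun i _ => Nat.sub_add_cancel (he i)
    obtain ⟨x, hx, hxt⟩ := ih (fun i => S i - e i) (by omega) (by
      intro i
      have h0 := h i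
      have h3 := he i
      by_cases h1 : i = a
      · have : e i = 1 := by subst h1; simp [e, hab.ne]
        omega
      · by_cases h2 : i = b
        · have : e i = 1 := by subst h2; simp [e, hab.ne']
          omega
        · have := hc i h1 h2
          have : e i = 0 := by simp [e, h1, h2]
          omega)
    refine ⟨fun i j => x i j + (if i = a then if j = b then 1 else 0 else 0), ?_, ?_⟩
    · intro i
      rw [nodeDeg_add N x (fun i j => if i = a then if j = b then 1 else 0 else 0),
        nodeDeg_unit N a b hab]
      have h1 := hx i
      have h2 := he i
      change nodeDeg N x i + e i ≤ S i
      omega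
    · rw [pairTotal_add N x (fun i j => if i = a then if j = b then 1 else 0 else 0),
        pairTotal_unit N a b hab, hxt]

theorem stmt5 (N : ℕ) (hN : 2 ≤ N) (S : Fin N → ℕ)
    (hmax : Finset.univ.sup S < ((∑ i, S i) + 1) / 2) :
    ∃ x : Fin N → Fin N → ℕ,
      (∀ i, nodeDeg N x i ≤ S i) ∧ pairTotal N x = (∑ i, S i) / 2 := by
  refine pairing_aux N _ S rfl fun i => ?_
  have : S i ≤ Finset.univ.sup S := Finset.le_sup (mem_univ i)
  omega
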